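/- Under Assumption (A), let f ∈ C^s with s = 1+ρ, ρ ∈ (0,1], and let θ_0 ∈ ℝ^d with f'(θ_0) ≠ 0. Then for all c > 0, the infimum over estimators T̂_n = T̂_n(X_1,…,X_n) of sup over θ with ‖θ − θ_0‖ ≤ c/√n of √n·‖T̂_n − f(θ)‖_{L_2(P_θ)}/σ_f(θ) is at least 1 − 3π/(√(8m)·c) − (2/√m)·(‖f‖_{C^s}/σ_f(θ_0))·(c/√n)^ρ. -/

import Mathlib

open MeasureTheory Real
open scoped RealInnerProductSpace BigOperators ENNReal NNReal

noncomputable section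

abbrev Euc (d : ℕ) : Type := EuclideanSpace ℝ (Fin d)

/-- The noise distribution with density `e^{-V(x)}` w.r.t. Lebesgue measure. -/
def noiseMeasure {d : ℕ} (V : Euc d → ℝ) : Measure (Euc d) :=
  MeasureTheory.volume.withDensity fun x => ENNReal.ofReal (Real.exp (-(V x)))

/-- The joint distribution of an i.i.d. sample `X_1, …, X_n` from `P_θ(dx) = e^{-V(x-θ)}dx`. -/
def sampleMeasure {d : ℕ} (V : Euc d → ℝ) (n : ℕ) (θ : Euc d) : Measure (Fin n → Euc d) :=
  Measure.pi fun _ => (noiseMeasure V).map (fun x => θ + x)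

/-- `ψ_α`-norm of a random variable: `sup_{p ≥ 1} p^{-1/α} (E|η|^p)^{1/p}`. -/
def psiNorm {Ω : Type*} [MeasurableSpace Ω] (α : ℝ) (μ : Measure Ω) (η : Ω → ℝ) : ℝ :=
  ⨆ p : {p : ℝ // 1 ≤ p}, (p : ℝ) ^ (-(1 / α)) * (∫ ω, |η ω| ^ (p : ℝ) ∂μ) ^ ((1 : ℝ) / (p : ℝ))

/-- `f` belongs to the Hölder ball of radius `B` in `C^s`, `s = l + ρ`. -/
def holderCLe {d : ℕ} (l : ℕ) (ρ : ℝ) (f : Euc d → ℝ) (B : ℝ) : Prop :=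
  ContDiff ℝ l f ∧
  (∀ j : ℕ, j ≤ l → ∀ x, ‖iteratedFDeriv ℝ j f x‖ ≤ B) ∧
  (∀ x y, ‖iteratedFDeriv ℝ l f x - iteratedFDeriv ℝ l f y‖ ≤ B * ‖x - y‖ ^ ρ)

/-- The operator `(T g)(θ) = E_θ g(θ̂)`. -/
def Texp {d : ℕ} (V : Euc d → ℝ) (n : ℕ) (hatθ : (Fin n → Euc d) → Euc d) (g : Euc d → ℝ) :
    Euc d → ℝ :=
  fun θ => ∫ x, g (hatθ x) ∂ sampleMeasure V n θ

/-- The operator `𝓑 = 𝓣 - Id`. -/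
def Bop {d : ℕ} (V : Euc d → ℝ) (n : ℕ) (hatθ : (Fin n → Euc d) → Euc d) :
    (Euc d → ℝ) → Euc d → ℝ :=
  fun g θ => Texp V n hatθ g θ - g θ

/-- The bias-corrected functional `f_k = Σ_{j=0}^k (-1)^j 𝓑^j f`. -/
def biasCorrect {d : ℕ} (V : Euc d → ℝ) (n : ℕ) (hatθ : (Fin n → Euc d) → Euc d) (k : ℕ)
    (f : Euc d → ℝ) : Euc d → ℝ :=
  fun θ => ∑ j ∈ Finset.range (k + 1), (-1 : ℝ) ^ j * (Bop V n hatθ)^[j] f θ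

/-- The Poincaré constant `c(V)` of the distribution `e^{-V(x)}dx`. -/
def poincareConst {d : ℕ} (V : Euc d → ℝ) : ℝ :=
  sInf {C : ℝ | 0 ≤ C ∧ ∀ g : Euc d → ℝ, LocallyLipschitz g →
    ∫ x, (g x - ∫ y, g y ∂ noiseMeasure V) ^ 2 ∂ noiseMeasure V ≤
      C * ∫ x, ‖gradient g x‖ ^ 2 ∂ noiseMeasure V}

theorem integral_cos_sq_window {a : ℝ} (ha : 0 < a) :
    ∫ t in -a..a, cos (π / (2 * a) * t) ^ 2 = a := by
  have hc : π / (2 * a) ≠ 0 := by positivity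
  have h1 : π / (2 * a) * a = π / 2 := by field_simp
  have h2 : π / (2 * a) * -a = -(π / 2) := by rw [← h1]; ring
  rw [intervalIntegral.integral_comp_mul_left (fun t => cos t ^ 2) hc, h1, h2, integral_cos_sq]
  simp
  field_simp

/-- The square root of the squared-cosine probability density on `[-a, a]`. -/
def cosWindow (a t : ℝ) : ℝ := cos (π / (2 * a) * t) / √a

/-- The derivative of `cosWindow a`. -/
def cosWindowDeriv (a t : ℝ) : ℝ := -(π / (2 * a) * sin (π / (2 * a) * t)) / √a

theorem hasDerivAt_cosWindow (a t : ℝ) : HasDerivAt (cosWindow a) (cosWindowDeriv a t) t := by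
  have h := (((hasDerivAt_id t).const_mul (π / (2 * a))).cos).div_const (√a)
  refine h.congr_deriv ?_
  simp [cosWindowDeriv]
  ring

@[fun_prop]
theorem continuous_cosWindow (a : ℝ) : Continuous (cosWindow a) := by
  unfold cosWindow; fun_prop

@[fun_prop]
theorem continuous_cosWindowDeriv (a : ℝ) : Continuous (cosWindowDeriv a) := by
  unfold cosWindowDeriv; fun_prop

theorem cosWindow_sq {a : ℝ} (ha : 0 < a) (t : ℝ) :
    cosWindow a t ^ 2 = cos (π / (2 * a) * t) ^ 2 / a := by
  rw [cosWindow, div_pow, sq_sqrt ha.le]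

theorem cosWindow_self {a : ℝ} (ha : 0 < a) : cosWindow a a = 0 := by
  have h1 : π / (2 * a) * a = π / 2 := by field_simp
  simp [cosWindow, h1]

theorem cosWindow_neg_self {a : ℝ} (ha : 0 < a) : cosWindow a (-a) = 0 := by
  have h1 : π / (2 * a) * a = π / 2 := by field_simp
  simp [cosWindow, h1]

theorem integral_cosWindow_sq {a : ℝ} (ha : 0 < a) :
    ∫ t in -a..a, cosWindow a t ^ 2 = 1 := by
  simp_rw [cosWindow_sq ha]
  rw [intervalIntegral.integral_div, integral_cos_sq_window ha, div_self ha.ne']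

theorem integral_cosWindowDeriv_sq {a : ℝ} (ha : 0 < a) :
    ∫ t in -a..a, 4 * cosWindowDeriv a t ^ 2 = π ^ 2 / a ^ 2 := by
  have h : ∀ t, 4 * cosWindowDeriv a t ^ 2
      = (π ^ 2 / a ^ 2) * (1 / a - cosWindow a t ^ 2) := by
    intro t
    rw [cosWindow_sq ha, cosWindowDeriv, div_pow, sq_sqrt ha.le, neg_sq, mul_pow, sin_sq]
    field_simp
    ring
  simp_rw [h]
  rw [intervalIntegral.integral_const_mul, intervalIntegral.integral_sub
    (by simp) ((by fun_prop : Continuous _).intervalIntegrable _ _), integral_cosWindow_sq ha]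
  simp
  field_simp
  ring

/-- A form of the **van Trees inequality** for a one-parameter family of probability densities
`p t` with scores `s t`, for the squared-cosine prior on `[-a, a]`: if the mean square error of
`T` as an estimator of `g t` is at most `K`, the Fisher information is `N` and `b ≤ g'`, then
`2 l b ≤ K + l² (N + π² / a²)` for every `l ≥ 0`. -/
theorem vanTrees_cosWindow {X : Type*} [MeasurableSpace X] (μ : Measure X) [SFinite μ]
    (p s : ℝ → X → ℝ) (g g' : ℝ → ℝ) (T : X → ℝ) {a N K b l : ℝ} (ha : 0 < a) (hK : 0 ≤ K)
    (hl : 0 ≤ l) (hp : Measurable (Function.uncurry p)) (hs : Measurable (Function.uncurry s))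
    (hT : Measurable T) (hp0 : ∀ t x, 0 ≤ p t x)
    (hder : ∀ x t, HasDerivAt (fun t => p t x) (s t x * p t x) t)
    (hscont : ∀ x, Continuous fun t => s t x)
    (hpi : ∀ t, Integrable (p t) μ) (hp1 : ∀ t, ∫ x, p t x ∂μ = 1)
    (hsi : ∀ t, Integrable (fun x => s t x * p t x) μ)
    (hs0 : ∀ t, ∫ x, s t x * p t x ∂μ = 0)
    (hs2i : ∀ t, Integrable (fun x => s t x ^ 2 * p t x) μ)
    (hs2 : ∀ t, ∫ x, s t x ^ 2 * p t x ∂μ = N)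
    (hg : ∀ t, HasDerivAt g (g' t) t) (hg' : Continuous g')
    (hgb : ∀ t ∈ Set.Icc (-a) a, b ≤ g' t)
    (hrisk : ∀ t ∈ Set.Icc (-a) a,
      ∫⁻ x, ENNReal.ofReal ((T x - g t) ^ 2 * p t x) ∂μ ≤ ENNReal.ofReal K) :
    2 * l * b ≤ K + l ^ 2 * (N + π ^ 2 / a ^ 2) := by
  have haa : -a ≤ a := by linarith
  have hgc : Continuous g := continuous_iff_continuousAt.2 fun t => (hg t).continuousAt
  have hpcont : ∀ x, Continuous fun t => p t x := fun x =>
    continuous_iff_continuousAt.2 fun t => (hder x t).continuousAt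
  set D : Measure ℝ := volume.restrict (Set.Ioc (-a) a) with hD
  have hpm : Measurable fun z : ℝ × X => p z.1 z.2 := hp
  have hsm : Measurable fun z : ℝ × X => s z.1 z.2 := hs
  have hvm : Measurable (cosWindow a) := (continuous_cosWindow a).measurable
  have hv'm : Measurable (cosWindowDeriv a) := (continuous_cosWindowDeriv a).measurable
  have hgm : Measurable g := hgc.measurable
  have hg'm : Measurable g' := hg'.measurable
  let A : ℝ × X → ℝ := fun z => (T z.2 - g z.1) * cosWindow a z.1
  let S : ℝ × X → ℝ := fun z => s z.1 z.2 * cosWindow a z.1 + 2 * cosWindowDeriv a z.1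
  have hAm : Measurable A := by fun_prop
  have hSm : Measurable S := by fun_prop
  have hmem : ∀ᵐ t ∂D, t ∈ Set.Icc (-a) a := by
    filter_upwards [ae_restrict_mem measurableSet_Ioc] with t ht using Set.Ioc_subset_Icc_self ht
  have hDint : ∀ F : ℝ → ℝ, ∫ t, F t ∂D = ∫ t in -a..a, F t := fun F =>
    (intervalIntegral.integral_of_le haa).symm
  have hDi : ∀ F : ℝ → ℝ, Continuous F → Integrable F D := fun F hF =>
    (intervalIntegrable_iff_integrableOn_Ioc_of_le haa).1 (hF.intervalIntegrable _ _)
  -- the risk term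
  have h1l : ∫⁻ z, ENNReal.ofReal (A z ^ 2 * p z.1 z.2) ∂(D.prod μ) ≤ ENNReal.ofReal K := by
    rw [lintegral_prod _ (by fun_prop)]
    calc ∫⁻ t, ∫⁻ x, ENNReal.ofReal (A (t, x) ^ 2 * p t x) ∂μ ∂D
        ≤ ∫⁻ t, ENNReal.ofReal (cosWindow a t ^ 2) * ENNReal.ofReal K ∂D := by
          refine lintegral_mono_ae ?_
          filter_upwards [hmem] with t ht
          calc ∫⁻ x, ENNReal.ofReal (A (t, x) ^ 2 * p t x) ∂μ
              = ∫⁻ x, ENNReal.ofReal (cosWindow a t ^ 2) *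
                  ENNReal.ofReal ((T x - g t) ^ 2 * p t x) ∂μ := by
                refine lintegral_congr fun x => ?_
                rw [← ENNReal.ofReal_mul (sq_nonneg _)]
                congr 1
                simp only [A]
                ring
            _ = ENNReal.ofReal (cosWindow a t ^ 2) *
                  ∫⁻ x, ENNReal.ofReal ((T x - g t) ^ 2 * p t x) ∂μ :=
                lintegral_const_mul' _ _ ENNReal.ofReal_ne_top
            _ ≤ _ := by gcongr; exact hrisk t ht
      _ = (∫⁻ t, ENNReal.ofReal (cosWindow a t ^ 2) ∂D) * ENNReal.ofReal K :=
          lintegral_mul_const' _ _ ENNReal.ofReal_ne_top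
      _ = ENNReal.ofReal K := by
          rw [← ofReal_integral_eq_lintegral_ofReal (hDi _ (by fun_prop))
            (Filter.Eventually.of_forall fun t => sq_nonneg _), hDint, integral_cosWindow_sq ha]
          simp
  have h1i : Integrable (fun z => A z ^ 2 * p z.1 z.2) (D.prod μ) := by
    refine ⟨by fun_prop, ?_⟩
    rw [hasFiniteIntegral_iff_ofReal
      (Filter.Eventually.of_forall fun z => mul_nonneg (sq_nonneg _) (hp0 _ _))]
    exact h1l.trans_lt ENNReal.ofReal_lt_top
  have h1 : ∫ z, A z ^ 2 * p z.1 z.2 ∂(D.prod μ) ≤ K := by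
    rw [integral_eq_lintegral_of_nonneg_ae
      (Filter.Eventually.of_forall fun z => mul_nonneg (sq_nonneg _) (hp0 _ _)) (by fun_prop)]
    exact ENNReal.toReal_le_of_le_ofReal hK h1l
  -- the information term
  have hslice : ∀ t, Integrable (fun x => S (t, x) ^ 2 * p t x) μ ∧
      ∫ x, S (t, x) ^ 2 * p t x ∂μ = cosWindow a t ^ 2 * N + 4 * cosWindowDeriv a t ^ 2 := by
    intro t
    have e : (fun x => S (t, x) ^ 2 * p t x) = fun x =>
        (cosWindow a t ^ 2 * (s t x ^ 2 * p t x)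
          + (4 * cosWindow a t * cosWindowDeriv a t) * (s t x * p t x))
          + (4 * cosWindowDeriv a t ^ 2) * p t x := by
      funext x
      simp only [S]
      ring
    have i1 := (hs2i t).const_mul (cosWindow a t ^ 2)
    have i2 := (hsi t).const_mul (4 * cosWindow a t * cosWindowDeriv a t)
    have i3 := (hpi t).const_mul (4 * cosWindowDeriv a t ^ 2)
    have i12 : Integrable (fun x => cosWindow a t ^ 2 * (s t x ^ 2 * p t x)
        + (4 * cosWindow a t * cosWindowDeriv a t) * (s t x * p t x)) μ := i1.add i2
    rw [e]
    refine ⟨i12.add i3, ?_⟩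
    rw [integral_add i12 i3, integral_add i1 i2]
    simp_rw [integral_const_mul]
    rw [hs2, hs0, hp1]
    ring
  have h2i : Integrable (fun z => S z ^ 2 * p z.1 z.2) (D.prod μ) := by
    rw [integrable_prod_iff (by fun_prop)]
    refine ⟨Filter.Eventually.of_forall fun t => (hslice t).1, ?_⟩
    have : (fun t => ∫ x, ‖S (t, x) ^ 2 * p t x‖ ∂μ)
        = fun t => cosWindow a t ^ 2 * N + 4 * cosWindowDeriv a t ^ 2 := by
      funext t
      rw [← (hslice t).2]
      refine integral_congr_ae (Filter.Eventually.of_forall fun x => ?_)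
      simp [abs_of_nonneg (hp0 t x)]
    simp only [this]
    exact hDi _ (by fun_prop)
  have h2 : ∫ z, S z ^ 2 * p z.1 z.2 ∂(D.prod μ) = N + π ^ 2 / a ^ 2 := by
    rw [integral_prod _ h2i]
    simp only [fun t => (hslice t).2]
    rw [integral_add (hDi _ (by fun_prop)) (hDi _ (by fun_prop)), hDint, hDint,
      integral_cosWindowDeriv_sq ha, intervalIntegral.integral_mul_const,
      integral_cosWindow_sq ha, one_mul]
  -- the cross term
  have h3i : Integrable (fun z => A z * S z * p z.1 z.2) (D.prod μ) := by
    refine (h1i.add h2i).mono' (by fun_prop) (Filter.Eventually.of_forall fun z => ?_)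
    have hz := hp0 z.1 z.2
    simp only [Pi.add_apply, norm_mul, Real.norm_eq_abs, abs_of_nonneg hz]
    rw [← add_mul]
    refine mul_le_mul_of_nonneg_right ?_ hz
    nlinarith [sq_nonneg (|A z| - |S z|), sq_abs (A z), sq_abs (S z), sq_nonneg (A z),
      sq_nonneg (S z)]
  have h4slice : ∀ t, ∫ x, g' t * cosWindow a t ^ 2 * p t x ∂μ = g' t * cosWindow a t ^ 2 := by
    intro t
    rw [integral_const_mul, hp1, mul_one]
  have h4i : Integrable (fun z : ℝ × X => g' z.1 * cosWindow a z.1 ^ 2 * p z.1 z.2)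
      (D.prod μ) := by
    rw [integrable_prod_iff (by fun_prop)]
    refine ⟨Filter.Eventually.of_forall fun t => (hpi t).const_mul (g' t * cosWindow a t ^ 2), ?_⟩
    have : (fun t => ∫ x, ‖g' t * cosWindow a t ^ 2 * p t x‖ ∂μ)
        = fun t => |g' t| * cosWindow a t ^ 2 := by
      funext t
      simp only [norm_mul, Real.norm_eq_abs, abs_of_nonneg (hp0 t _)]
      rw [integral_const_mul, hp1, mul_one, abs_of_nonneg (sq_nonneg (cosWindow a t))]
    simp only [this]
    exact hDi _ (by fun_prop)
  have hparts : ∀ x, ∫ t, A (t, x) * S (t, x) * p t x ∂D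
      = ∫ t, g' t * cosWindow a t ^ 2 * p t x ∂D := by
    intro x
    rw [hDint, hDint]
    have hpc := hpcont x
    have hsc := hscont x
    have hu : ∀ t, HasDerivAt (fun t => T x - g t) (-g' t) t := fun t =>
      (hg t).const_sub (T x)
    have hv : ∀ t, HasDerivAt (fun t => cosWindow a t ^ 2 * p t x)
        (cosWindow a t * S (t, x) * p t x) t := by
      intro t
      refine (((hasDerivAt_cosWindow a t).pow 2).mul (hder x t)).congr_deriv ?_
      simp only [S, Pi.pow_apply]
      push_cast
      ring
    have key := intervalIntegral.integral_mul_deriv_eq_deriv_mul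
      (a := -a) (b := a) (fun t _ => hu t) (fun t _ => hv t)
      ((by fun_prop : Continuous fun t => -g' t).intervalIntegrable _ _)
      ((by simp only [S]; fun_prop :
        Continuous fun t => cosWindow a t * S (t, x) * p t x).intervalIntegrable _ _)
    rw [cosWindow_self ha, cosWindow_neg_self ha] at key
    calc ∫ t in -a..a, A (t, x) * S (t, x) * p t x
        = ∫ t in -a..a, (T x - g t) * (cosWindow a t * S (t, x) * p t x) := by
          refine intervalIntegral.integral_congr fun t _ => ?_
          simp only [A]
          ring
      _ = _ := by
          rw [key]
          simp only [neg_mul, intervalIntegral.integral_neg]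
          simp [mul_assoc]
  have h3 : b ≤ ∫ z, A z * S z * p z.1 z.2 ∂(D.prod μ) := by
    rw [integral_prod_symm _ h3i]
    simp only [hparts]
    rw [← integral_prod_symm (fun z : ℝ × X => g' z.1 * cosWindow a z.1 ^ 2 * p z.1 z.2) h4i,
      integral_prod _ h4i]
    simp only [h4slice]
    calc b = ∫ t, b * cosWindow a t ^ 2 ∂D := by
          rw [integral_const_mul, hDint, integral_cosWindow_sq ha, mul_one]
      _ ≤ _ := by
          refine integral_mono_ae (hDi _ (by fun_prop)) (hDi _ (by fun_prop)) ?_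
          filter_upwards [hmem] with t ht
          exact mul_le_mul_of_nonneg_right (hgb t ht) (sq_nonneg _)
  have hfin : 2 * l * ∫ z, A z * S z * p z.1 z.2 ∂(D.prod μ)
      ≤ ∫ z, A z ^ 2 * p z.1 z.2 ∂(D.prod μ)
        + l ^ 2 * ∫ z, S z ^ 2 * p z.1 z.2 ∂(D.prod μ) := by
    rw [← integral_const_mul, ← integral_const_mul, ← integral_add h1i (h2i.const_mul _)]
    refine integral_mono (h3i.const_mul _) (h1i.add (h2i.const_mul _)) fun z => ?_
    have := mul_nonneg (sq_nonneg (A z - l * S z)) (hp0 z.1 z.2)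
    simp only
    nlinarith
  rw [h2] at hfin
  nlinarith [mul_le_mul_of_nonneg_left h3 (by positivity : 0 ≤ 2 * l)]

theorem integrable_exp_neg {d : ℕ} {V : Euc d → ℝ} (h1 : ∫ x, Real.exp (-(V x)) = 1) :
    Integrable fun x => Real.exp (-(V x)) := by
  by_contra h
  rw [integral_undef h] at h1
  exact zero_ne_one h1

theorem isProbabilityMeasure_noiseMeasure {d : ℕ} {V : Euc d → ℝ}
    (h1 : ∫ x, Real.exp (-(V x)) = 1) : IsProbabilityMeasure (noiseMeasure V) := by
  constructor
  rw [noiseMeasure, withDensity_apply _ MeasurableSet.univ, Measure.restrict_univ,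
    ← ofReal_integral_eq_lintegral_ofReal (integrable_exp_neg h1)
      (Filter.Eventually.of_forall fun x => (Real.exp_pos _).le), h1, ENNReal.ofReal_one]

theorem map_add_noiseMeasure {d : ℕ} (V : Euc d → ℝ) (θ : Euc d) :
    (noiseMeasure V).map (fun x => θ + x) = noiseMeasure fun x => V (x - θ) := by
  ext s hs
  have hm : Measurable fun x : Euc d => θ + x := by fun_prop
  rw [Measure.map_apply hm hs, noiseMeasure, noiseMeasure, withDensity_apply _ (hm hs),
    withDensity_apply _ hs, ← lintegral_indicator (hm hs), ← lintegral_indicator hs,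
    ← lintegral_add_left_eq_self
      (s.indicator fun x => ENNReal.ofReal (Real.exp (-(V (x - θ))))) θ]
  refine lintegral_congr fun x => ?_
  by_cases h : θ + x ∈ s
  · rw [Set.indicator_of_mem (show x ∈ (fun x => θ + x) ⁻¹' s from h), Set.indicator_of_mem h,
      add_sub_cancel_left]
  · rw [Set.indicator_of_notMem (show x ∉ (fun x => θ + x) ⁻¹' s from h),
      Set.indicator_of_notMem h]

theorem pi_noiseMeasure {d : ℕ} {V : Euc d → ℝ}
    (h1 : ∫ x, Real.exp (-(V x)) = 1) (n : ℕ) :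
    Measure.pi (fun _ : Fin n => noiseMeasure V)
      = volume.withDensity fun x => ENNReal.ofReal (Real.exp (-∑ i, V (x i))) := by
  have := isProbabilityMeasure_noiseMeasure h1
  have hi := integrable_exp_neg h1
  refine Measure.pi_eq fun s hs => ?_
  rw [withDensity_apply _ (MeasurableSet.univ_pi hs), volume_pi, Measure.restrict_pi_pi]
  have e : ∀ x : Fin n → Euc d, Real.exp (-∑ i, V (x i)) = ∏ i, Real.exp (-V (x i)) := by
    intro x
    rw [← Finset.sum_neg_distrib, Real.exp_sum]
  simp_rw [e]
  rw [← ofReal_integral_eq_lintegral_ofReal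
      (Integrable.fintype_prod_dep (f := fun _ x => Real.exp (-V x)) fun i => hi.integrableOn)
      (Filter.Eventually.of_forall fun x => Finset.prod_nonneg fun i _ => (Real.exp_pos _).le),
    integral_fintype_prod_eq_prod (fun _ x => Real.exp (-V x)),
    ENNReal.ofReal_prod_of_nonneg fun i _ => integral_nonneg fun x => (Real.exp_pos _).le]
  refine Finset.prod_congr rfl fun i _ => ?_
  rw [noiseMeasure, withDensity_apply _ (hs i), ofReal_integral_eq_lintegral_ofReal hi.integrableOn
      (Filter.Eventually.of_forall fun x => (Real.exp_pos _).le)]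

theorem sampleMeasure_eq_withDensity {d : ℕ} {V : Euc d → ℝ}
    (h1 : ∫ x, Real.exp (-(V x)) = 1) (n : ℕ) (θ : Euc d) :
    sampleMeasure V n θ
      = volume.withDensity fun x => ENNReal.ofReal (Real.exp (-∑ i, V (x i - θ))) := by
  rw [sampleMeasure, map_add_noiseMeasure]
  exact pi_noiseMeasure (V := fun x => V (x - θ))
    (by rw [integral_sub_right_eq_self (fun x => Real.exp (-(V x))) θ, h1]) n

theorem integrable_noiseMeasure_iff {d : ℕ} {V : Euc d → ℝ} (hV : Continuous V)
    {E : Type*} [NormedAddCommGroup E] [NormedSpace ℝ E] (h : Euc d → E) :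
    Integrable h (noiseMeasure V) ↔ Integrable fun x => Real.exp (-(V x)) • h x := by
  have hm := hV.measurable
  rw [noiseMeasure, integrable_withDensity_iff_integrable_smul' (by fun_prop) (by simp)]
  simp only [ENNReal.toReal_ofReal (Real.exp_pos _).le]

theorem integral_noiseMeasure {d : ℕ} {V : Euc d → ℝ} (hV : Continuous V)
    {E : Type*} [NormedAddCommGroup E] [NormedSpace ℝ E] (h : Euc d → E) :
    ∫ x, h x ∂noiseMeasure V = ∫ x, Real.exp (-(V x)) • h x := by
  have hm := hV.measurable
  rw [noiseMeasure, integral_withDensity_eq_integral_toReal_smul (by fun_prop) (by simp)]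
  simp only [ENNReal.toReal_ofReal (Real.exp_pos _).le]

/-- Mean and second moment of a sum of i.i.d. centered square-integrable variables. -/
theorem sum_pi_moments {Ω : Type*} [MeasurableSpace Ω] (ν : Measure Ω) [IsProbabilityMeasure ν]
    {φ : Ω → ℝ} (hφ : MemLp φ 2 ν) (h0 : ∫ x, φ x ∂ν = 0) (n : ℕ) :
    MemLp (fun x : Fin n → Ω => ∑ i, φ (x i)) 2 (Measure.pi fun _ => ν) ∧
    ∫ x : Fin n → Ω, ∑ i, φ (x i) ∂(Measure.pi fun _ => ν) = 0 ∧
    ∫ x : Fin n → Ω, (∑ i, φ (x i)) ^ 2 ∂(Measure.pi fun _ => ν) = n * ∫ x, φ x ^ 2 ∂ν := by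
  have hm : MemLp (fun x : Fin n → Ω => ∑ i, φ (x i)) 2 (Measure.pi fun _ => ν) :=
    memLp_finsetSum _ fun i _ =>
      hφ.comp_measurePreserving (measurePreserving_eval (fun _ : Fin n => ν) i)
  have hint : Integrable φ ν := hφ.integrable (by norm_num)
  have h0' : ∫ x : Fin n → Ω, ∑ i, φ (x i) ∂(Measure.pi fun _ => ν) = 0 := by
    rw [integral_finsetSum _ fun i _ => integrable_comp_eval hint]
    refine Finset.sum_eq_zero fun i _ => ?_
    rw [integral_comp_eval (μ := fun _ : Fin n => ν) hint.aestronglyMeasurable, h0]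
  refine ⟨hm, h0', ?_⟩
  have key := ProbabilityTheory.variance_sum_pi (μ := fun _ : Fin n => ν) (X := fun _ => φ)
    fun _ => hφ
  have e : (∑ i : Fin n, fun ω : Fin n → Ω => φ (ω i)) = fun ω => ∑ i, φ (ω i) := by
    funext ω
    simp
  rw [e, ProbabilityTheory.variance_of_integral_eq_zero hm.aestronglyMeasurable.aemeasurable h0',
    ProbabilityTheory.variance_of_integral_eq_zero hφ.aestronglyMeasurable.aemeasurable h0] at key
  simpa using key

theorem continuous_gradient {d : ℕ} {V : Euc d → ℝ} (hV : ContDiff ℝ 1 V) :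
    Continuous (gradient V) :=
  (InnerProductSpace.toDual ℝ (Euc d)).symm.continuous.comp (hV.continuous_fderiv (by norm_num))

/-- The score of a differentiable location family has mean zero. -/
theorem integral_inner_gradient_eq_zero {d : ℕ} {V : Euc d → ℝ} (hV : ContDiff ℝ 1 V)
    (h1 : ∫ x, Real.exp (-(V x)) = 1) (u : Euc d)
    (hi : Integrable (fun x => ⟪gradient V x, u⟫) (noiseMeasure V)) :
    ∫ x, ⟪gradient V x, u⟫ ∂noiseMeasure V = 0 := by
  have hd : ∀ x, HasFDerivAt V (fderiv ℝ V x) x := fun x =>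
    (hV.differentiable (by norm_num) x).hasFDerivAt
  rw [integral_noiseMeasure hV.continuous]
  rw [integrable_noiseMeasure_iff hV.continuous] at hi
  have key := integral_bilinear_hasLineDerivAt_right_eq_neg_left_of_integrable
    (μ := (volume : Measure (Euc d))) (f := fun _ => (1 : ℝ)) (f' := fun _ => 0)
    (g := fun x => Real.exp (-(V x))) (g' := fun x => Real.exp (-(V x)) * -⟪gradient V x, u⟫)
    (v := u) (B := ContinuousLinearMap.mul ℝ ℝ) (by simp) (by simpa using hi.neg)
    (by simpa using integrable_exp_neg h1) (fun x _ => (hasFDerivAt_const (1 : ℝ) x).hasLineDerivAt u) ?_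
  · simpa [integral_neg] using key
  · intro x _
    have := ((hd x).neg.exp).hasLineDerivAt u
    simpa [inner_gradient_left] using this


theorem isProbabilityMeasure_sampleMeasure {d : ℕ} {V : Euc d → ℝ}
    (h1 : ∫ x, Real.exp (-(V x)) = 1) (n : ℕ) (θ : Euc d) :
    IsProbabilityMeasure (sampleMeasure V n θ) := by
  have := isProbabilityMeasure_noiseMeasure h1
  have : IsProbabilityMeasure ((noiseMeasure V).map fun x => θ + x) :=
    Measure.isProbabilityMeasure_map (by fun_prop)
  unfold sampleMeasure
  infer_instance

/-- Moments of the directional score of an i.i.d. sample from a location family. -/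
theorem sampleMeasure_score_moments {d : ℕ} {V : Euc d → ℝ} (hV : ContDiff ℝ 1 V)
    (h1 : ∫ x, Real.exp (-(V x)) = 1) (u : Euc d)
    (hφ : MemLp (fun x => ⟪gradient V x, u⟫) 2 (noiseMeasure V)) (n : ℕ) (θ : Euc d) :
    MemLp (fun x : Fin n → Euc d => ∑ i, ⟪gradient V (x i - θ), u⟫) 2 (sampleMeasure V n θ) ∧
    ∫ x, ∑ i, ⟪gradient V (x i - θ), u⟫ ∂sampleMeasure V n θ = 0 ∧
    ∫ x, (∑ i, ⟪gradient V (x i - θ), u⟫) ^ 2 ∂sampleMeasure V n θ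
      = n * ∫ x, ⟪gradient V x, u⟫ ^ 2 ∂noiseMeasure V := by
  have := isProbabilityMeasure_noiseMeasure h1
  have hVg := continuous_gradient hV
  have hφc : Continuous fun x => ⟪gradient V x, u⟫ := by fun_prop
  have : IsProbabilityMeasure ((noiseMeasure V).map fun x => θ + x) :=
    Measure.isProbabilityMeasure_map (by fun_prop)
  have hint : ∀ F : Euc d → ℝ, Continuous F →
      ∫ x, F (x - θ) ∂((noiseMeasure V).map fun x => θ + x) = ∫ x, F x ∂noiseMeasure V := by
    intro F hF
    rw [integral_map (by fun_prop)
      (by fun_prop : Continuous fun x => F (x - θ)).aestronglyMeasurable]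
    simp
  have hL : MemLp (fun x => ⟪gradient V (x - θ), u⟫) 2
      ((noiseMeasure V).map fun x => θ + x) := by
    rw [memLp_map_measure_iff
      (by fun_prop : Continuous fun x => ⟪gradient V (x - θ), u⟫).aestronglyMeasurable
      (by fun_prop)]
    simpa [Function.comp_def] using hφ
  have h := sum_pi_moments _ hL
    (by rw [hint (fun x => ⟪gradient V x, u⟫) hφc,
          integral_inner_gradient_eq_zero hV h1 u (hφ.integrable (by norm_num))]) n
  rw [hint (fun x => ⟪gradient V x, u⟫ ^ 2) (by fun_prop)] at h
  exact h

/-- The van Trees bound for the location family along the line `t ↦ θ₀ + t u`. -/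
theorem vanTrees_location {d : ℕ} {V f : Euc d → ℝ} (hV : ContDiff ℝ 1 V)
    (h1 : ∫ x, Real.exp (-(V x)) = 1) (hf : ContDiff ℝ 1 f) (θ₀ u : Euc d)
    (hφ : MemLp (fun x => ⟪gradient V x, u⟫) 2 (noiseMeasure V)) (n : ℕ)
    {T : (Fin n → Euc d) → ℝ} (hT : Measurable T) {a b K l : ℝ} (ha : 0 < a) (hK : 0 ≤ K)
    (hl : 0 ≤ l) (hb : ∀ t ∈ Set.Icc (-a) a, b ≤ ⟪gradient f (θ₀ + t • u), u⟫)
    (hrisk : ∀ t ∈ Set.Icc (-a) a,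
      ∫⁻ x, ENNReal.ofReal ((T x - f (θ₀ + t • u)) ^ 2) ∂sampleMeasure V n (θ₀ + t • u)
        ≤ ENNReal.ofReal K) :
    2 * l * b ≤ K + l ^ 2 *
      (n * ∫ x, ⟪gradient V x, u⟫ ^ 2 ∂noiseMeasure V + π ^ 2 / a ^ 2) := by
  have := isProbabilityMeasure_noiseMeasure h1
  have hVc := hV.continuous
  have hVg := continuous_gradient hV
  have hfg := continuous_gradient hf
  have hφc : Continuous fun x => ⟪gradient V x, u⟫ := by fun_prop
  have hmom := sampleMeasure_score_moments hV h1 u hφ n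
  let p : ℝ → (Fin n → Euc d) → ℝ := fun t x => Real.exp (-∑ i, V (x i - (θ₀ + t • u)))
  let s : ℝ → (Fin n → Euc d) → ℝ := fun t x => ∑ i, ⟪gradient V (x i - (θ₀ + t • u)), u⟫
  have hpc : Continuous fun z : ℝ × (Fin n → Euc d) => p z.1 z.2 := by
    simp only [p]; fun_prop
  have hsc : Continuous fun z : ℝ × (Fin n → Euc d) => s z.1 z.2 := by
    simp only [s]; fun_prop
  have hpt : ∀ t, Measurable fun x => ENNReal.ofReal (p t x) := fun t => by
    have : Continuous (p t) := hpc.comp (by fun_prop : Continuous fun x => (t, x))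
    exact this.measurable.ennreal_ofReal
  have hsample : ∀ t, sampleMeasure V n (θ₀ + t • u)
      = volume.withDensity fun x => ENNReal.ofReal (p t x) := fun t =>
    sampleMeasure_eq_withDensity h1 n _
  have hp0 : ∀ t x, 0 ≤ p t x := fun t x => (Real.exp_pos _).le
  have hi : ∀ t (F : (Fin n → Euc d) → ℝ), Integrable F (sampleMeasure V n (θ₀ + t • u)) ↔
      Integrable fun x => F x * p t x := by
    intro t F
    rw [hsample, integrable_withDensity_iff_integrable_smul' (hpt t) (by simp)]
    simp only [ENNReal.toReal_ofReal (hp0 _ _), smul_eq_mul, mul_comm]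
  have hI : ∀ t (F : (Fin n → Euc d) → ℝ), ∫ x, F x ∂sampleMeasure V n (θ₀ + t • u)
      = ∫ x, F x * p t x := by
    intro t F
    rw [hsample, integral_withDensity_eq_integral_toReal_smul (hpt t) (by simp)]
    simp only [ENNReal.toReal_ofReal (hp0 _ _), smul_eq_mul, mul_comm]
  have hsp := isProbabilityMeasure_sampleMeasure h1 n
  have hpm : Measurable (Function.uncurry p) := hpc.measurable
  have hsm : Measurable (Function.uncurry s) := hsc.measurable
  have hst : ∀ x, Continuous fun t => s t x := fun x => by
    simp only [s]; fun_prop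
  have hg' : Continuous fun t : ℝ => ⟪gradient f (θ₀ + t • u), u⟫ := by fun_prop
  refine vanTrees_cosWindow (volume : Measure (Fin n → Euc d)) p s (fun t => f (θ₀ + t • u))
    (fun t => ⟪gradient f (θ₀ + t • u), u⟫) T ha hK hl hpm hsm hT hp0
    (fun x t => ?_) hst (fun t => ?_) (fun t => ?_) (fun t => ?_) (fun t => ?_) (fun t => ?_)
    (fun t => ?_) (fun t => ?_) hg' hb (fun t ht => ?_)
  · have hline : ∀ y : Euc d, HasDerivAt (fun t : ℝ => y - (θ₀ + t • u)) (-u) t := fun y => by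
      simpa using (((hasDerivAt_id t).smul_const u).const_add θ₀).const_sub y
    have hVi : ∀ i, HasDerivAt (fun t : ℝ => V (x i - (θ₀ + t • u)))
        (-⟪gradient V (x i - (θ₀ + t • u)), u⟫) t := fun i => by
      have := ((hV.differentiable (by norm_num) _).hasFDerivAt).comp_hasDerivAt t (hline (x i))
      exact this.congr_deriv (by simp [inner_gradient_left])
    refine ((HasDerivAt.fun_sum fun i (_ : i ∈ Finset.univ) => hVi i).fun_neg.exp).congr_deriv ?_
    simp [p, s, mul_comm]
  · simpa using (hi t fun _ => 1).1 (integrable_const 1)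
  · simpa using (hI t fun _ => 1).symm
  · exact (hi t _).1 ((hmom _).1.integrable (by norm_num))
  · rw [← hI t (s t)]
    exact (hmom _).2.1
  · exact (hi t _).1 (hmom _).1.integrable_sq
  · rw [← hI t (fun x => s t x ^ 2)]
    exact (hmom _).2.2
  · have hline : HasDerivAt (fun t : ℝ => θ₀ + t • u) u t := by
      simpa using ((hasDerivAt_id t).smul_const u).const_add θ₀
    have := ((hf.differentiable (by norm_num) _).hasFDerivAt).comp_hasDerivAt t hline
    exact this.congr_deriv (by simp [inner_gradient_left])
  · refine le_trans (le_of_eq ?_) (hrisk t ht)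
    have hTm : Measurable fun x => ENNReal.ofReal ((T x - f (θ₀ + t • u)) ^ 2) := by fun_prop
    rw [hsample, lintegral_withDensity_eq_lintegral_mul _ (hpt t) hTm]
    refine lintegral_congr fun x => ?_
    rw [Pi.mul_apply, ← ENNReal.ofReal_mul (hp0 _ _), mul_comm]

/-- The seminorm of a positive semidefinite symmetric operator is subadditive. -/
theorem sqrt_inner_add_le {d : ℕ} (A : Euc d →L[ℝ] Euc d) (hs : ∀ x y, ⟪A x, y⟫ = ⟪A y, x⟫)
    (h0 : ∀ x, 0 ≤ ⟪A x, x⟫) (x y : Euc d) :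
    √⟪A (x + y), x + y⟫ ≤ √⟪A x, x⟫ + √⟪A y, y⟫ := by
  have hcs : ⟪A x, y⟫ ^ 2 ≤ ⟪A x, x⟫ * ⟪A y, y⟫ := by
    have := LinearMap.BilinForm.apply_sq_le_of_symm
      (((innerₗ (Euc d)).comp A.toLinearMap : LinearMap.BilinForm ℝ (Euc d)))
      (fun x => h0 x) ⟨fun x y => hs x y⟩ x y
    simpa using this
  have hle : ⟪A x, y⟫ ≤ √⟪A x, x⟫ * √⟪A y, y⟫ := by
    rw [← Real.sqrt_mul (h0 x)]
    exact Real.le_sqrt_of_sq_le hcs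
  rw [Real.sqrt_le_left (by positivity), map_add, inner_add_left, inner_add_right,
    inner_add_right, hs y x, add_sq, Real.sq_sqrt (h0 x), Real.sq_sqrt (h0 y)]
  linarith

theorem holderCLe_one_gradient {d : ℕ} {ρ B : ℝ} {f : Euc d → ℝ} (hf : holderCLe 1 ρ f B)
    (x y : Euc d) : ‖gradient f x - gradient f y‖ ≤ B * ‖x - y‖ ^ ρ := by
  refine le_trans (le_of_eq ?_) (hf.2.2 x y)
  rw [← dist_eq_norm, ← dist_eq_norm, ← iteratedFDerivWithin_univ,
    dist_iteratedFDerivWithin_one f f uniqueDiffWithinAt_univ uniqueDiffWithinAt_univ, fderivWithin_univ]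
  exact LinearIsometryEquiv.dist_map _ _ _

theorem one_sub_le_of_sq_le {R δ y : ℝ} (hR : 0 ≤ R) (hδ : 0 ≤ δ) (hy : 0 ≤ y)
    (h : (1 - δ) ^ 2 ≤ R ^ 2 * (1 + δ) ^ 2 * (1 + y ^ 2)) : 1 - y - 2 * δ ≤ R := by
  have h2 : (1 - δ) ≤ R * (1 + δ) * (1 + y) := by
    refine le_of_sq_le_sq ?_ (by positivity)
    have : R ^ 2 * (1 + δ) ^ 2 * (1 + y ^ 2) ≤ R ^ 2 * (1 + δ) ^ 2 * (1 + y) ^ 2 := by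
      gcongr
      nlinarith
    nlinarith
  by_contra hlt
  push Not at hlt
  have h3 : R * ((1 + δ) * (1 + y)) < (1 - y - 2 * δ) * ((1 + δ) * (1 + y)) :=
    mul_lt_mul_of_pos_right hlt (by positivity)
  nlinarith [mul_nonneg hδ hy, sq_nonneg y, sq_nonneg δ, mul_nonneg hδ (sq_nonneg y),
    mul_nonneg hy (sq_nonneg δ)]

section FisherInformation

variable {d : ℕ} {V : Euc d → ℝ} {J Jinv : Euc d →L[ℝ] Euc d} {m : ℝ}

theorem integrable_fisher (hm : 0 < m)
    (hJ : ∀ u, J u = ∫ x, ⟪gradient V x, u⟫ • gradient V x ∂noiseMeasure V)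
    (hJm : ∀ u, m * ‖u‖ ^ 2 ≤ ⟪J u, u⟫) (u : Euc d) :
    Integrable (fun x => ⟪gradient V x, u⟫ • gradient V x) (noiseMeasure V) := by
  by_cases hu : u = 0
  · simp [hu]
  by_contra h
  have h0 : J u = 0 := by rw [hJ, integral_undef h]
  have h1 := hJm u
  rw [h0, inner_zero_left] at h1
  have : 0 < ‖u‖ := norm_pos_iff.2 hu
  have : 0 < m * ‖u‖ ^ 2 := by positivity
  linarith

theorem inner_fisher (hm : 0 < m)
    (hJ : ∀ u, J u = ∫ x, ⟪gradient V x, u⟫ • gradient V x ∂noiseMeasure V)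
    (hJm : ∀ u, m * ‖u‖ ^ 2 ≤ ⟪J u, u⟫) (u v : Euc d) :
    ⟪J u, v⟫ = ∫ x, ⟪gradient V x, u⟫ * ⟪gradient V x, v⟫ ∂noiseMeasure V := by
  rw [real_inner_comm, hJ, ← integral_inner (integrable_fisher hm hJ hJm u)]
  simp only [real_inner_smul_right, real_inner_comm]

theorem fisher_symm (hm : 0 < m)
    (hJ : ∀ u, J u = ∫ x, ⟪gradient V x, u⟫ • gradient V x ∂noiseMeasure V)
    (hJm : ∀ u, m * ‖u‖ ^ 2 ≤ ⟪J u, u⟫) (u v : Euc d) : ⟪J u, v⟫ = ⟪J v, u⟫ := by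
  rw [inner_fisher hm hJ hJm, inner_fisher hm hJ hJm]
  simp only [mul_comm]

theorem memLp_score (hm : 0 < m) (hV : ContDiff ℝ 1 V)
    (hJ : ∀ u, J u = ∫ x, ⟪gradient V x, u⟫ • gradient V x ∂noiseMeasure V)
    (hJm : ∀ u, m * ‖u‖ ^ 2 ≤ ⟪J u, u⟫) (u : Euc d) :
    MemLp (fun x => ⟪gradient V x, u⟫) 2 (noiseMeasure V) := by
  have hVg := continuous_gradient hV
  rw [memLp_two_iff_integrable_sq
    (by fun_prop : Continuous fun x => ⟪gradient V x, u⟫).aestronglyMeasurable]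
  have := (integrable_fisher hm hJ hJm u).inner_const (𝕜 := ℝ) u
  simpa only [real_inner_smul_left, sq] using this

theorem fisherInv_symm (hJs : ∀ u v, ⟪J u, v⟫ = ⟪J v, u⟫) (hJi : ∀ u, J (Jinv u) = u)
    (u v : Euc d) : ⟪Jinv u, v⟫ = ⟪Jinv v, u⟫ := by
  have h := hJs (Jinv v) (Jinv u)
  rw [hJi, hJi] at h
  rw [real_inner_comm, h, real_inner_comm]

theorem mul_norm_fisherInv_sq_le (hJm : ∀ u, m * ‖u‖ ^ 2 ≤ ⟪J u, u⟫)
    (hJi : ∀ u, J (Jinv u) = u) (u : Euc d) : m * ‖Jinv u‖ ^ 2 ≤ ⟪Jinv u, u⟫ := by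
  have h := hJm (Jinv u)
  rwa [hJi, real_inner_comm] at h

theorem fisherInv_nonneg (hm : 0 < m) (hJm : ∀ u, m * ‖u‖ ^ 2 ≤ ⟪J u, u⟫)
    (hJi : ∀ u, J (Jinv u) = u) (u : Euc d) : 0 ≤ ⟪Jinv u, u⟫ :=
  le_trans (by positivity) (mul_norm_fisherInv_sq_le hJm hJi u)

theorem sqrt_fisherInv_le (hm : 0 < m) (hJm : ∀ u, m * ‖u‖ ^ 2 ≤ ⟪J u, u⟫)
    (hJi : ∀ u, J (Jinv u) = u) (u : Euc d) : √⟪Jinv u, u⟫ ≤ ‖u‖ / √m := by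
  have h1 := mul_norm_fisherInv_sq_le hJm hJi u
  have h2 : ⟪Jinv u, u⟫ ≤ ‖Jinv u‖ * ‖u‖ := real_inner_le_norm _ _
  refine Real.sqrt_le_iff.2 ⟨by positivity, ?_⟩
  rw [div_pow, Real.sq_sqrt hm.le, le_div_iff₀ hm]
  have h3 : (m * ‖Jinv u‖) * (m * ‖Jinv u‖) ≤ (m * ‖Jinv u‖) * ‖u‖ := by
    nlinarith
  have h4 : m * ‖Jinv u‖ ≤ ‖u‖ := by
    rcases (by positivity : 0 ≤ m * ‖Jinv u‖).eq_or_lt with h | h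
    · rw [← h]; positivity
    · exact le_of_mul_le_mul_left h3 h
  nlinarith [norm_nonneg u]

end FisherInformation

/-- A bound on a weighted root mean square error bounds the mean square error. -/
theorem le_ofReal_sq_of_mul_rpow_le {E : ℝ≥0∞} {q R : ℝ} (hq : 0 < q) (hR : 0 ≤ R)
    (h : ENNReal.ofReal q * E ^ ((1 : ℝ) / 2) ≤ ENNReal.ofReal R) :
    E ≤ ENNReal.ofReal ((R / q) ^ 2) := by
  have h1 : E ^ ((1 : ℝ) / 2) ≤ ENNReal.ofReal (R / q) := by
    rw [ENNReal.ofReal_div_of_pos hq, ENNReal.le_div_iff_mul_le (by simp [hq]) (by simp), mul_comm]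
    exact h
  have h2 : E = (E ^ ((1 : ℝ) / 2)) ^ (2 : ℝ) := by
    rw [← ENNReal.rpow_mul]; norm_num
  rw [h2, ENNReal.ofReal_pow (by positivity), ← ENNReal.rpow_natCast]
  exact ENNReal.rpow_le_rpow h1 (by norm_num)

/-- Proposition 2.7 / `min_max_lower_local`: local minimax lower bound in a
`c/√n`-neighborhood of `θ₀` for estimation of `f(θ)`, normalized by `σ_f(θ)`. -/
theorem stmt_5 :
    ∀ (L M m ρ : ℝ),
      0 < L → 0 < M → 0 < m → 0 < ρ → ρ ≤ 1 →
      ∀ (d n : ℕ) (V f : Euc d → ℝ) (J Jinv : Euc d →L[ℝ] Euc d) (B : ℝ),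
        0 < n →
        StrictConvexOn ℝ Set.univ V →
        ContDiff ℝ 2 V →
        (∫ x, Real.exp (-(V x)) = 1) →
        (∀ x, ‖iteratedFDeriv ℝ 2 V x‖ ≤ M) →
        (∀ x y, ‖iteratedFDeriv ℝ 2 V x - iteratedFDeriv ℝ 2 V y‖ ≤ L * ‖x - y‖) →
        (∀ u, J u = ∫ x, ⟪gradient V x, u⟫ • gradient V x ∂ noiseMeasure V) →
        (∀ u : Euc d, m * ‖u‖ ^ 2 ≤ ⟪J u, u⟫) →
        (∀ u, J (Jinv u) = u) →
        (∀ u, Jinv (J u) = u) →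
        holderCLe 1 ρ f B →
        ∀ θ₀ : Euc d, gradient f θ₀ ≠ 0 →
          ∀ c : ℝ, 0 < c →
            ∀ T : (Fin n → Euc d) → ℝ, Measurable T →
              ENNReal.ofReal
                  (1 - 3 * Real.pi / (Real.sqrt (8 * m) * c) -
                    2 / Real.sqrt m *
                      (B / Real.sqrt ⟪Jinv (gradient f θ₀), gradient f θ₀⟫) *
                        (c / Real.sqrt n) ^ ρ) ≤
                ⨆ θ : {θ : Euc d // ‖θ - θ₀‖ ≤ c / Real.sqrt n},
                  ENNReal.ofReal
                      (Real.sqrt n /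
                        Real.sqrt ⟪Jinv (gradient f θ.1), gradient f θ.1⟫) *
                    (∫⁻ x, ENNReal.ofReal ((T x - f θ.1) ^ 2)
                        ∂ sampleMeasure V n θ.1) ^ ((1 : ℝ) / 2) := by
  intro L M m ρ _ _ hm hρ _ d n V f J Jinv B hn _ hV2 h1 _ _ hJ hJm hJi _ hf θ₀ hg0 c hc T hT
  have hV : ContDiff ℝ 1 V := hV2.of_le (by norm_num)
  have hf1 : ContDiff ℝ 1 f := hf.1
  have hB : 0 ≤ B := (norm_nonneg _).trans (hf.2.1 0 (by norm_num) 0)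
  have hnR : (0 : ℝ) < n := by exact_mod_cast hn
  have hJs := fisher_symm hm hJ hJm
  have hinv0 := fisherInv_nonneg hm hJm hJi
  have htri := sqrt_inner_add_le Jinv (fisherInv_symm hJs hJi) hinv0
  set g0 := gradient f θ₀ with hg0_def
  set w := Jinv g0 with hw
  have hw0 : w ≠ 0 := fun h => hg0 (by rw [← hJi g0, ← hw, h, map_zero])
  have hr : 0 < ‖w‖ := norm_pos_iff.2 hw0
  have hmr : m * ‖w‖ ^ 2 ≤ ⟪w, g0⟫ := mul_norm_fisherInv_sq_le hJm hJi g0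
  have hσ2 : 0 < ⟪w, g0⟫ := lt_of_lt_of_le (by positivity) hmr
  set σ := √⟪w, g0⟫ with hσ_def
  have hσ : 0 < σ := Real.sqrt_pos.2 hσ2
  have hσsq : σ ^ 2 = ⟪w, g0⟫ := Real.sq_sqrt hσ2.le
  have hsm : 0 < √m := Real.sqrt_pos.2 hm
  have hsn : 0 < √(n : ℝ) := Real.sqrt_pos.2 hnR
  have hrσ : √m * ‖w‖ ≤ σ := by
    refine Real.le_sqrt_of_sq_le ?_
    rwa [mul_pow, Real.sq_sqrt hm.le]
  set a := c / √(n : ℝ) with ha_def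
  have ha : 0 < a := by positivity
  set δ := B * a ^ ρ / (√m * σ) with hδ_def
  have hδ : 0 ≤ δ := by positivity
  set y := π * ‖w‖ / (c * σ) with hy_def
  have hy : 0 ≤ y := by positivity
  -- comparison of the claimed bound with `1 - y - 2 δ`
  have hconst : 1 - 3 * π / (√(8 * m) * c) - 2 / √m * (B / σ) * a ^ ρ ≤ 1 - y - 2 * δ := by
    have e1 : 2 / √m * (B / σ) * a ^ ρ = 2 * δ := by
      rw [hδ_def]; field_simp
    have e2 : y ≤ 3 * π / (√(8 * m) * c) := by
      have h8 : √(8 * m) ≤ 3 * √m := by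
        rw [Real.sqrt_le_left (by positivity), mul_pow, Real.sq_sqrt hm.le]
        linarith
      have h8p : 0 < √(8 * m) := by positivity
      rw [hy_def, div_le_div_iff₀ (by positivity) (by positivity)]
      have h9 : ‖w‖ * √(8 * m) ≤ 3 * σ := by nlinarith
      calc π * ‖w‖ * (√(8 * m) * c) = (π * c) * (‖w‖ * √(8 * m)) := by ring
        _ ≤ (π * c) * (3 * σ) := by gcongr
        _ = 3 * π * (c * σ) := by ring
    rw [e1]
    linarith
  refine (ENNReal.ofReal_le_ofReal hconst).trans ?_
  by_cases hδ1 : 1 / 2 ≤ δ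
  · rw [ENNReal.ofReal_of_nonpos (by linarith)]
    exact zero_le
  push Not at hδ1
  set Q := ⨆ θ : {θ : Euc d // ‖θ - θ₀‖ ≤ a},
    ENNReal.ofReal (√(n : ℝ) / √⟪Jinv (gradient f θ.1), gradient f θ.1⟫) *
      (∫⁻ x, ENNReal.ofReal ((T x - f θ.1) ^ 2) ∂sampleMeasure V n θ.1) ^ ((1 : ℝ) / 2) with hQ
  by_cases hQtop : Q = ⊤
  · rw [hQtop]; exact le_top
  obtain ⟨R, hR, hQR⟩ : ∃ R : ℝ, 0 ≤ R ∧ Q = ENNReal.ofReal R :=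
    ⟨Q.toReal, ENNReal.toReal_nonneg, (ENNReal.ofReal_toReal hQtop).symm⟩
  rw [hQR]
  refine ENNReal.ofReal_le_ofReal ?_
  have hgrad : ∀ θ, ‖θ - θ₀‖ ≤ a → ‖gradient f θ - g0‖ ≤ B * a ^ ρ := fun θ hθ =>
    (holderCLe_one_gradient hf θ θ₀).trans (by gcongr)
  have hδσ : B * a ^ ρ / √m = σ * δ := by
    rw [hδ_def]; field_simp
  -- uniform bound for the mean square error on the ball
  have hrisk : ∀ θ, ‖θ - θ₀‖ ≤ a →
      ∫⁻ x, ENNReal.ofReal ((T x - f θ) ^ 2) ∂sampleMeasure V n θ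
        ≤ ENNReal.ofReal ((R / (√(n : ℝ) / (σ * (1 + δ)))) ^ 2) := by
    intro θ hθ
    set gθ := gradient f θ with hgθ
    have hdiff : ∀ z : Euc d, ‖z‖ ≤ B * a ^ ρ → √⟪Jinv z, z⟫ ≤ σ * δ := fun z hz => by
      rw [← hδσ]
      exact (sqrt_fisherInv_le hm hJm hJi z).trans (by gcongr)
    have hup : √⟪Jinv gθ, gθ⟫ ≤ σ * (1 + δ) := by
      have h := htri g0 (gθ - g0)
      rw [add_sub_cancel] at h
      have h' := hdiff _ (hgrad θ hθ)
      have h'' : √⟪Jinv g0, g0⟫ = σ := rfl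
      linarith
    have hpos : 0 < √⟪Jinv gθ, gθ⟫ := by
      have h := htri gθ (g0 - gθ)
      rw [add_sub_cancel] at h
      have h' := hdiff (g0 - gθ) (by rw [norm_sub_rev]; exact hgrad θ hθ)
      have h'' : √⟪Jinv g0, g0⟫ = σ := rfl
      nlinarith
    refine le_ofReal_sq_of_mul_rpow_le (by positivity) hR ?_
    calc _ ≤ ENNReal.ofReal (√(n : ℝ) / √⟪Jinv gθ, gθ⟫) *
          (∫⁻ x, ENNReal.ofReal ((T x - f θ) ^ 2) ∂sampleMeasure V n θ) ^ ((1 : ℝ) / 2) := by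
          gcongr
      _ ≤ Q := le_iSup (fun θ : {θ : Euc d // ‖θ - θ₀‖ ≤ a} =>
          ENNReal.ofReal (√(n : ℝ) / √⟪Jinv (gradient f θ.1), gradient f θ.1⟫) *
            (∫⁻ x, ENNReal.ofReal ((T x - f θ.1) ^ 2) ∂sampleMeasure V n θ.1) ^ ((1 : ℝ) / 2))
          ⟨θ, hθ⟩
      _ = ENNReal.ofReal R := hQR
  -- the least favourable direction
  set u := ‖w‖⁻¹ • w with hu
  have hu1 : ‖u‖ = 1 := by
    rw [hu, norm_smul, norm_inv, norm_norm, inv_mul_cancel₀ hr.ne']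
  have hline : ∀ t ∈ Set.Icc (-a) a, ‖(θ₀ + t • u) - θ₀‖ ≤ a := by
    intro t ht
    rw [add_sub_cancel_left, norm_smul, hu1, mul_one]
    exact abs_le.2 ht
  have hg0u : ⟪g0, u⟫ = σ ^ 2 / ‖w‖ := by
    rw [hu, real_inner_smul_right, real_inner_comm, hσsq]
    field_simp
  have hIu : ∫ x, ⟪gradient V x, u⟫ ^ 2 ∂noiseMeasure V = σ ^ 2 / ‖w‖ ^ 2 := by
    have h := inner_fisher hm hJ hJm u u
    simp only [← sq] at h
    rw [← h, hu, map_smul, hw, hJi, ← hw, real_inner_smul_left, real_inner_smul_right,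
      real_inner_comm, ← hσsq]
    field_simp
  set N := (n : ℝ) * (σ ^ 2 / ‖w‖ ^ 2) + π ^ 2 / a ^ 2 with hN
  have hNpos : 0 < N := by positivity
  set b := σ ^ 2 / ‖w‖ * (1 - δ) with hb_def
  have hbpos : 0 < b := mul_pos (by positivity) (by linarith)
  have hb : ∀ t ∈ Set.Icc (-a) a, b ≤ ⟪gradient f (θ₀ + t • u), u⟫ := by
    intro t ht
    have h := hgrad _ (hline t ht)
    have h' : |⟪gradient f (θ₀ + t • u) - g0, u⟫| ≤ B * a ^ ρ := by
      refine (abs_real_inner_le_norm _ _).trans ?_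
      rwa [hu1, mul_one]
    rw [inner_sub_left, hg0u] at h'
    have h2 := (abs_le.1 h').1
    have h3 : B * a ^ ρ ≤ σ ^ 2 / ‖w‖ * δ := by
      have e : B * a ^ ρ = √m * (σ * δ) := by
        rw [← hδσ]; field_simp
      rw [e, div_mul_eq_mul_div, le_div_iff₀ hr]
      calc √m * (σ * δ) * ‖w‖ = (σ * δ) * (√m * ‖w‖) := by ring
        _ ≤ (σ * δ) * σ := by gcongr
        _ = σ ^ 2 * δ := by ring
    rw [hb_def]
    linarith
  have hvt := vanTrees_location hV h1 hf1 θ₀ u (memLp_score hm hV hJ hJm u) n hT ha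
    (sq_nonneg (R / (√(n : ℝ) / (σ * (1 + δ))))) (div_nonneg hbpos.le hNpos.le) hb
    (fun t ht => hrisk _ (hline t ht))
  rw [hIu, ← hN] at hvt
  have hvt' : b ^ 2 ≤ (R / (√(n : ℝ) / (σ * (1 + δ)))) ^ 2 * N := by
    have e : 2 * (b / N) * b - (b / N) ^ 2 * N = b ^ 2 / N := by
      field_simp
      ring
    rw [← div_le_iff₀ hNpos]
    linarith
  refine one_sub_le_of_sq_le hR hδ hy ?_
  have eN : N = n * (σ ^ 2 / ‖w‖ ^ 2) * (1 + y ^ 2) := by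
    rw [hN, hy_def, ha_def, div_pow c, Real.sq_sqrt hnR.le]
    field_simp
  have eR : (R / (√(n : ℝ) / (σ * (1 + δ)))) ^ 2 = R ^ 2 * σ ^ 2 * (1 + δ) ^ 2 / n := by
    rw [div_div_eq_mul_div, div_pow, Real.sq_sqrt hnR.le]
    ring
  have eb : b ^ 2 = (σ ^ 4 / ‖w‖ ^ 2) * (1 - δ) ^ 2 := by
    rw [hb_def]; ring
  rw [eN, eR, eb] at hvt'
  have e : R ^ 2 * σ ^ 2 * (1 + δ) ^ 2 / n * (n * (σ ^ 2 / ‖w‖ ^ 2) * (1 + y ^ 2))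
      = (σ ^ 4 / ‖w‖ ^ 2) * (R ^ 2 * (1 + δ) ^ 2 * (1 + y ^ 2)) := by
    field_simp
  rw [e] at hvt'
  exact le_of_mul_le_mul_left hvt' (by positivity)
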